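/- Let {Γ_t}_{t≥0} ⊂ C(D,A) be a semicocycle over a semigroup F ⊂ C(D) that is jointly continuous on [0,∞)×D. If the semicocycle is uniformly jointly continuous at t = 0 (for every x0 ∈ D there is a neighborhood U with sup_{x∈U}‖Γ_t(x) − 1_A‖ → 0 as t → 0⁺), then it is uniformly jointly continuous at every t0 ≥ 0. -/

import Mathlib

open Filter Metric Set Topology

/-- Points in `W` are times at which the semigroup is almost jointly continuous at `x0`. -/
theorem semigroup_dense_aux {X : Type*} [PseudoMetricSpace X] (D : Set X) (F : ℝ → X → X)
    (hFmaps : ∀ t ≥ (0:ℝ), Set.MapsTo (F t) D D)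
    (hFc : ∀ t ≥ (0:ℝ), ContinuousOn (F t) D)
    (hr : ∀ t ≥ (0:ℝ), ∀ x ∈ D, Tendsto (fun s => F s x) (𝓝[>] t) (𝓝 (F t x)))
    (x0 : X) (hx0 : x0 ∈ D) (ε : ℝ) (hε : 0 < ε) (a b : ℝ) (ha : 0 ≤ a) (hab : a < b) :
    ∃ t ∈ Ioo a b, ∃ N ∈ 𝓝 t, ∃ U ∈ 𝓝 x0, ∀ s ∈ N, ∀ s' ∈ N, ∀ x ∈ U ∩ D,
      dist (F s x) (F s' x0) < ε := by
  obtain ⟨c, hac, hcb⟩ := exists_between hab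
  have h1 : ∀ᶠ s in 𝓝[>] c, dist (F s x0) (F c x0) < ε / 4 :=
    (hr c (by linarith) x0 hx0).eventually (Metric.ball_mem_nhds _ (by positivity))
  obtain ⟨d, hcd, hd⟩ := (mem_nhdsGT_iff_exists_Ioo_subset' hcb).1 h1
  let A : ℕ → Set ℝ := fun n => {t | t ≤ 0 ∨ ∀ x ∈ Metric.ball x0 (1 / ((n:ℝ) + 1)) ∩ D,
    dist (F t x) (F t x0) ≤ ε / 4}
  have hA : ⋃ n, closure (A n) = univ := by
    rw [eq_univ_iff_forall]
    intro t
    rw [mem_iUnion]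
    rcases le_or_gt t 0 with ht | ht
    · exact ⟨0, subset_closure (Or.inl ht)⟩
    · have h2 := (hFc t ht.le x0 hx0).eventually (Metric.ball_mem_nhds _ (show 0 < ε / 4 by positivity))
      rw [eventually_nhdsWithin_iff, Metric.eventually_nhds_iff_ball] at h2
      obtain ⟨r, hr0, h2⟩ := h2
      obtain ⟨n, hn⟩ := exists_nat_one_div_lt hr0
      refine ⟨n, subset_closure (Or.inr ?_)⟩
      rintro x ⟨hx, hxD⟩
      exact (h2 x (Metric.ball_subset_ball hn.le hx) hxD).le
  have hden := dense_iUnion_interior_of_closed (fun n => isClosed_closure (s := A n)) hA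
  have hc0 : 0 < c := by linarith
  have hcd' : c < min d b := lt_min hcd hcb
  obtain ⟨t, htI, ht⟩ := hden.inter_open_nonempty (Ioo c (min d b)) isOpen_Ioo (nonempty_Ioo.2 hcd')
  obtain ⟨n, hn⟩ := mem_iUnion.1 ht
  refine ⟨t, ⟨by linarith [htI.1], htI.2.trans_le (min_le_right _ _)⟩,
    Ioo c (min d b) ∩ interior (closure (A n)),
    (isOpen_Ioo.inter isOpen_interior).mem_nhds ⟨htI, hn⟩,
    Metric.ball x0 (1 / ((n:ℝ) + 1)), Metric.ball_mem_nhds _ (by positivity), ?_⟩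
  rintro s ⟨hs, hsn⟩ s' ⟨hs', -⟩ x hx
  have hs0 : 0 < s := hc0.trans hs.1
  have key : dist (F s x) (F s x0) ≤ ε / 4 := by
    by_contra! hcon
    have hT : Tendsto (fun r => dist (F r x) (F r x0)) (𝓝[>] s) (𝓝 (dist (F s x) (F s x0))) :=
      (hr s hs0.le x hx.2).dist (hr s hs0.le x0 hx0)
    have h3 := hT.eventually (lt_mem_nhds hcon)
    have h4 : ∀ᶠ r in 𝓝[>] s, r ∈ interior (closure (A n)) :=
      nhdsWithin_le_nhds (isOpen_interior.mem_nhds hsn)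
    obtain ⟨e, hse, he⟩ := mem_nhdsGT_iff_exists_Ioo_subset.1 (h3.and h4)
    obtain ⟨m, hm⟩ := nonempty_Ioo.2 (mem_Ioi.1 hse)
    have hmcl : m ∈ closure (A n) := interior_subset (he hm).2
    obtain ⟨q, hq, hqA⟩ := mem_closure_iff.1 hmcl _ isOpen_Ioo hm
    have h5 : ε / 4 < dist (F q x) (F q x0) := (he hq).1
    rcases hqA with h | h
    · linarith [hq.1]
    · linarith [h x hx]
  have e1 : dist (F s x0) (F c x0) < ε / 4 := hd ⟨hs.1, hs.2.trans_le (min_le_left _ _)⟩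
  have e2 : dist (F s' x0) (F c x0) < ε / 4 := hd ⟨hs'.1, hs'.2.trans_le (min_le_left _ _)⟩
  have e3 := dist_triangle (F s x) (F s x0) (F s' x0)
  have e4 := dist_triangle_right (F s x0) (F s' x0) (F c x0)
  linarith

/-- A semigroup of continuous maps, strongly right continuous at zero, is jointly
continuous at positive times. -/
theorem semigroup_joint {X : Type*} [PseudoMetricSpace X] (D : Set X) (F : ℝ → X → X)
    (hFmaps : ∀ t ≥ (0:ℝ), Set.MapsTo (F t) D D)
    (hFc : ∀ t ≥ (0:ℝ), ContinuousOn (F t) D)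
    (hFsg : ∀ t ≥ (0:ℝ), ∀ s ≥ (0:ℝ), ∀ x ∈ D, F (t + s) x = F t (F s x))
    (hF0 : ∀ x ∈ D, Tendsto (fun t => F t x) (𝓝[>] (0:ℝ)) (𝓝 x))
    (x0 : X) (hx0 : x0 ∈ D) (t0 : ℝ) (ht0 : 0 < t0) (V : Set X) (hV : V ∈ 𝓝 (F t0 x0)) :
    ∃ δ > 0, ∃ U ∈ 𝓝 x0, ∀ t, |t - t0| < δ → ∀ x ∈ U ∩ D, F t x ∈ V := by
  have hr : ∀ t ≥ (0:ℝ), ∀ x ∈ D, Tendsto (fun s => F s x) (𝓝[>] t) (𝓝 (F t x)) := by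
    intro t ht x hx
    have h1 := hF0 (F t x) (hFmaps t ht hx)
    have h2 : Tendsto (fun s => s - t) (𝓝[>] t) (𝓝[>] 0) := by
      apply tendsto_nhdsWithin_iff.2 ⟨?_, ?_⟩
      · have : Tendsto (fun s => s - t) (𝓝 t) (𝓝 (t - t)) := by
          exact (continuous_id.sub continuous_const).tendsto t
        rw [sub_self] at this
        exact this.mono_left nhdsWithin_le_nhds
      · filter_upwards [self_mem_nhdsWithin] with s hs
        exact sub_pos.2 (mem_Ioi.1 hs)
    refine (h1.comp h2).congr' ?_
    filter_upwards [self_mem_nhdsWithin] with s hs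
    have hs' : t < s := hs
    rw [Function.comp_apply, ← hFsg (s - t) (by linarith) t ht x hx, sub_add_cancel]
  let W : ℕ → Set ℝ := fun k => interior {t | ∃ N ∈ 𝓝 t, ∃ U ∈ 𝓝 x0, ∀ s ∈ N, ∀ s' ∈ N,
    ∀ x ∈ U ∩ D, dist (F s x) (F s' x0) < 1 / ((k:ℝ) + 1)} ∪ Iio 0
  have hWo : ∀ k, IsOpen (W k) := fun k => isOpen_interior.union isOpen_Iio
  have hWd : ∀ k, Dense (W k) := by
    intro k
    rw [dense_iff_inter_open]
    rintro V hVo ⟨r, hrV⟩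
    rcases lt_or_ge r 0 with h | h
    · exact ⟨r, hrV, Or.inr h⟩
    · have : V ∈ 𝓝[>] r := nhdsWithin_le_nhds (hVo.mem_nhds hrV)
      obtain ⟨b, hb, hbV⟩ := mem_nhdsGT_iff_exists_Ioo_subset.1 this
      obtain ⟨t, ht, N, hN, U, hU, hNU⟩ := semigroup_dense_aux D F hFmaps hFc hr x0 hx0
        (1 / ((k:ℝ) + 1)) (by positivity) r b h hb
      refine ⟨t, hbV ht, Or.inl ?_⟩
      rw [mem_interior_iff_mem_nhds]
      filter_upwards [eventually_mem_nhds_iff.2 hN] with t' ht'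
      exact ⟨N, ht', U, hU, hNU⟩
  obtain ⟨t1, ht1, ht1W⟩ := (dense_iInter_of_isOpen hWo hWd).inter_open_nonempty (Ioo 0 t0)
    isOpen_Ioo (nonempty_Ioo.2 ht0)
  have hu : 0 ≤ t0 - t1 := by linarith [ht1.2]
  have hFt : F t0 x0 = F (t0 - t1) (F t1 x0) := by
    rw [← hFsg _ hu _ ht1.1.le _ hx0, sub_add_cancel]
  rw [hFt] at hV
  have h2 := (hFc _ hu _ (hFmaps _ ht1.1.le hx0)).eventually hV
  rw [eventually_nhdsWithin_iff, Metric.eventually_nhds_iff_ball] at h2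
  obtain ⟨r, hr0, h2⟩ := h2
  obtain ⟨k, hk⟩ := exists_nat_one_div_lt hr0
  rcases mem_iInter.1 ht1W k with h | h
  · obtain ⟨N, hN, U, hU, hNU⟩ := interior_subset h
    obtain ⟨δ, hδ, hδN⟩ := Metric.mem_nhds_iff.1 hN
    refine ⟨min δ t1, lt_min hδ ht1.1, U, hU, ?_⟩
    intro t ht x hx
    have hta := abs_lt.1 (ht.trans_le (min_le_right _ _))
    have hs0 : 0 ≤ t - (t0 - t1) := by linarith
    have e : F t x = F (t0 - t1) (F (t - (t0 - t1)) x) := by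
      rw [← hFsg _ hu _ hs0 _ hx.2]; congr 1; ring
    rw [e]
    refine h2 _ ?_ (hFmaps _ hs0 hx.2)
    refine Metric.mem_ball.2 ((hNU _ (hδN ?_) _ (mem_of_mem_nhds hN) x hx).trans hk)
    rw [Metric.mem_ball, Real.dist_eq]
    have : t - (t0 - t1) - t1 = t - t0 := by ring
    rw [this]
    exact ht.trans_le (min_le_left _ _)
  · have h' : t1 < 0 := h
    linarith [ht1.1]

/-- A semicocycle over a semigroup which is uniformly jointly continuous at `t = 0`
is uniformly jointly continuous at every `t0 ≥ 0`. -/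
theorem UJC_at_zero_implies_UJC
    {X A : Type*} [NormedAddCommGroup X] [NormedSpace ℂ X] [CompleteSpace X]
    [NormedRing A] [NormedAlgebra ℂ A] [CompleteSpace A] [NormOneClass A]
    (D : Set X) (hDo : IsOpen D) (hDc : IsConnected D)
    (F : ℝ → X → X)
    (hFmaps : ∀ t ≥ (0:ℝ), Set.MapsTo (F t) D D)
    (hFc : ∀ t ≥ (0:ℝ), ContinuousOn (F t) D)
    (hFsg : ∀ t ≥ (0:ℝ), ∀ s ≥ (0:ℝ), ∀ x ∈ D, F (t + s) x = F t (F s x))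
    (hF0 : ∀ x ∈ D, Tendsto (fun t => F t x) (𝓝[>] (0:ℝ)) (𝓝 x))
    (Γ : ℝ → X → A)
    (hΓc : ∀ t ≥ (0:ℝ), ContinuousOn (Γ t) D)
    (hchain : ∀ t ≥ (0:ℝ), ∀ s ≥ (0:ℝ), ∀ x ∈ D, Γ (t + s) x = Γ t (F s x) * Γ s x)
    (hΓ0 : ∀ x ∈ D, Tendsto (fun t => Γ t x) (𝓝[>] (0:ℝ)) (𝓝 1))
    (hΓjc : ContinuousOn (fun p : ℝ × X => Γ p.1 p.2) (Set.Ici (0:ℝ) ×ˢ D))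
    (hUJC0 : ∀ x0 ∈ D, ∃ U ∈ 𝓝 x0, U ⊆ D ∧
      TendstoUniformlyOn (fun t x => Γ t x) (fun _ => (1:A)) (𝓝[Set.Ici (0:ℝ)] 0) U) :
    ∀ t0 ≥ (0:ℝ), ∀ x0 ∈ D, ∃ U ∈ 𝓝 x0, U ⊆ D ∧
      TendstoUniformlyOn (fun t x => Γ t x) (Γ t0) (𝓝[Set.Ici (0:ℝ)] t0) U := by
  intro t0 ht0 x0 hx0
  obtain ⟨V, hV, -, hVu⟩ := hUJC0 (F t0 x0) (hFmaps t0 ht0 hx0)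
  have hl : ∃ δ > 0, ∃ U ∈ 𝓝 x0, ∀ t, 0 ≤ t → t < t0 → |t - t0| < δ → ∀ x ∈ U ∩ D,
      F t x ∈ V := by
    rcases ht0.eq_or_lt with h | h
    · exact ⟨1, one_pos, univ, univ_mem, fun t h1 h2 => by linarith⟩
    · obtain ⟨δ, hδ, U, hU, hh⟩ := semigroup_joint D F hFmaps hFc hFsg hF0 x0 hx0 t0 h V hV
      exact ⟨δ, hδ, U, hU, fun t _ _ => hh t⟩
  obtain ⟨δ, hδ, U, hU, hUV⟩ := hl
  have hD : D ∈ 𝓝 x0 := hDo.mem_nhds hx0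
  have hU1 : ∀ᶠ x in 𝓝 x0, F t0 x ∈ V :=
    ((hFc t0 ht0).continuousAt hD).eventually hV
  obtain ⟨M, hM⟩ : ∃ M, ‖Γ t0 x0‖ < M := exists_gt _
  have hM0 : 0 < M := (norm_nonneg _).trans_lt hM
  have hU2 : ∀ᶠ x in 𝓝 x0, ‖Γ t0 x‖ < M :=
    ((hΓc t0 ht0).continuousAt hD).norm.eventually (gt_mem_nhds hM)
  refine ⟨(U ∩ {x | F t0 x ∈ V ∧ ‖Γ t0 x‖ < M}) ∩ D,
    inter_mem (inter_mem hU (hU1.and hU2)) hD, inter_subset_right, ?_⟩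
  rw [Metric.tendstoUniformlyOn_iff] at hVu ⊢
  intro ε hε
  have hη : 0 < min (1/2) (ε / (2 * M)) := by positivity
  obtain ⟨η, hη0, hηm⟩ := exists_between hη
  have hη1 : η < 1 / 2 := hηm.trans_le (min_le_left _ _)
  have hη2 : η * (2 * M) < ε := (lt_div_iff₀ (by positivity)).1 (hηm.trans_le (min_le_right _ _))
  have h3 := hVu η hη0
  rw [eventually_nhdsWithin_iff, Metric.eventually_nhds_iff_ball] at h3
  obtain ⟨r, hr0, h3⟩ := h3
  have h3' : ∀ h, 0 ≤ h → h < r → ∀ y ∈ V, ‖Γ h y - 1‖ ≤ η := by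
    intro h h0 hr y hy
    rw [← dist_eq_norm, dist_comm]
    refine (h3 h ?_ h0 y hy).le
    rw [Metric.mem_ball, Real.dist_eq, sub_zero, abs_of_nonneg h0]
    exact hr
  rw [eventually_nhdsWithin_iff, Metric.eventually_nhds_iff_ball]
  refine ⟨min r δ, lt_min hr0 hδ, ?_⟩
  intro t ht ht0' x hx
  have ht' : 0 ≤ t := ht0'
  obtain ⟨⟨hxU, hxV, hxM⟩, hxD⟩ := hx
  rw [Metric.mem_ball, Real.dist_eq] at ht
  have htr := abs_lt.1 (ht.trans_le (min_le_left _ _))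
  rcases le_or_gt t0 t with hle | hlt
  · have hG := h3' (t - t0) (by linarith) (by linarith) _ hxV
    have e := hchain (t - t0) (by linarith) t0 ht0 x hxD
    rw [sub_add_cancel] at e
    rw [dist_comm, dist_eq_norm, e, ← sub_one_mul]
    calc _ ≤ ‖Γ (t - t0) (F t0 x) - 1‖ * ‖Γ t0 x‖ := norm_mul_le _ _
      _ ≤ η * M := by gcongr
      _ < ε := by nlinarith
  · have hy := hUV t ht' hlt (ht.trans_le (min_le_right _ _)) x ⟨hxU, hxD⟩
    have hG := h3' (t0 - t) (by linarith) (by linarith) _ hy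
    have e := hchain (t0 - t) (by linarith) t ht' x hxD
    rw [sub_add_cancel] at e
    have hd : ‖Γ t0 x - Γ t x‖ ≤ η * ‖Γ t x‖ := by
      rw [e, ← sub_one_mul]
      exact (norm_mul_le _ _).trans (by gcongr)
    have hb : ‖Γ t x‖ ≤ ‖Γ t0 x‖ + ‖Γ t0 x - Γ t x‖ := by
      have := norm_sub_le (Γ t0 x) (Γ t0 x - Γ t x)
      rwa [sub_sub_cancel] at this
    have hb2 : ‖Γ t x‖ ≤ 2 * M := by nlinarith [norm_nonneg (Γ t x)]
    rw [dist_eq_norm]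
    calc _ ≤ η * ‖Γ t x‖ := hd
      _ ≤ η * (2 * M) := by gcongr
      _ < ε := hη2
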